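/- For every k ≥ 2, CPDL(TWₖ) has the TWₖ-model property: if a formula φ ∈ CPDL(TWₖ) is satisfiable, then it is satisfiable in a countable Kripke structure of tree-width at most k. -/

import Mathlib

set_option linter.unusedVariables false

/-! ## Kripke structures -/

/-- A Kripke structure with worlds `W`, atomic propositions `P` and atomic programs `A`. -/
structure Kripke (W P A : Type) where
  rel : A → W → W → Prop
  val : P → W → Prop

/-! ## Syntax of `CPDL+` with loop and intersection (master language) -/

mutual
  /-- Formulas of loop/intersection CPDL+:  `p | ¬φ | φ∧φ | ⟨π⟩ | loop(π)`. -/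
  inductive PDLFormula : Type where
    | prop  : ℕ → PDLFormula
    | neg   : PDLFormula → PDLFormula
    | conj  : PDLFormula → PDLFormula → PDLFormula
    | diam  : PDLProgram → PDLFormula
    | floop : PDLProgram → PDLFormula
  /-- Programs: `ε | a | ā | π∪π | π∘π | π* | φ? | π∩π | C[x_s,x_t]`. -/
  inductive PDLProgram : Type where
    | eps    : PDLProgram
    | atom   : ℕ → PDLProgram
    | conv   : ℕ → PDLProgram
    | punion : PDLProgram → PDLProgram → PDLProgram
    | comp   : PDLProgram → PDLProgram → PDLProgram
    | star   : PDLProgram → PDLProgram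
    | test   : PDLFormula → PDLProgram
    | inter  : PDLProgram → PDLProgram → PDLProgram
    | cprog  : AtomList → ℕ → ℕ → PDLProgram
  /-- A finite list of atoms `π(x,y)` (a "conjunctive program body" `C`). -/
  inductive AtomList : Type where
    | nil   : AtomList
    | acons : PDLProgram → ℕ → ℕ → AtomList → AtomList
end

/-! ## Semantics -/

mutual
  /-- Satisfaction `⟦φ⟧_K ⊆ W`. -/
  def PDLFormula.sat {W : Type} (K : Kripke W ℕ ℕ) : PDLFormula → W → Prop
    | .prop p, w => K.val p w
    | .neg φ, w => ¬ PDLFormula.sat K φ w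
    | .conj φ ψ, w => PDLFormula.sat K φ w ∧ PDLFormula.sat K ψ w
    | .diam π, w => ∃ v, PDLProgram.rel K π w v
    | .floop π, w => PDLProgram.rel K π w w
  termination_by φ _ => sizeOf φ
  /-- Binary relation `⟦π⟧_K ⊆ W × W`. -/
  def PDLProgram.rel {W : Type} (K : Kripke W ℕ ℕ) : PDLProgram → W → W → Prop
    | .eps, u, v => u = v
    | .atom a, u, v => K.rel a u v
    | .conv a, u, v => K.rel a v u
    | .punion π ρ, u, v => PDLProgram.rel K π u v ∨ PDLProgram.rel K ρ u v
    | .comp π ρ, u, v => ∃ w, PDLProgram.rel K π u w ∧ PDLProgram.rel K ρ w v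
    | .star π, u, v => Relation.ReflTransGen (fun a b => PDLProgram.rel K π a b) u v
    | .test φ, u, v => u = v ∧ PDLFormula.sat K φ u
    | .inter π ρ, u, v => PDLProgram.rel K π u v ∧ PDLProgram.rel K ρ u v
    | .cprog C xs xt, u, v => ∃ f : ℕ → W, f xs = u ∧ f xt = v ∧ AtomList.sat K C f
  termination_by π _ _ => sizeOf π
  /-- `f` is a `C`-satisfying assignment. -/
  def AtomList.sat {W : Type} (K : Kripke W ℕ ℕ) : AtomList → (ℕ → W) → Prop
    | .nil, _ => True
    | .acons π x y C, f => PDLProgram.rel K π (f x) (f y) ∧ AtomList.sat K C f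
  termination_by C _ => sizeOf C
end

/-- Semantic equivalence of formulas (on every Kripke structure). -/
def FormEquiv (φ ψ : PDLFormula) : Prop :=
  ∀ (W : Type) (K : Kripke W ℕ ℕ) (w : W), φ.sat K w ↔ ψ.sat K w

/-- Semantic equivalence of programs (on every Kripke structure). -/
def ProgEquiv (π ρ : PDLProgram) : Prop :=
  ∀ (W : Type) (K : Kripke W ℕ ℕ) (u v : W), π.rel K u v ↔ ρ.rel K u v

/-! ## Graphs (undirected, possibly with self-loops), tree decompositions -/

/-- An undirected graph (self-loop edges are allowed; `adj` is intended symmetric). -/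
structure UGraph (V : Type) where
  verts : Set V
  adj : V → V → Prop

/-- Connectedness of a graph. -/
def UGraph.Connected {V : Type} (G : UGraph V) : Prop :=
  G.verts.Nonempty ∧ ∀ x ∈ G.verts, ∀ y ∈ G.verts, Relation.ReflTransGen G.adj x y

/-- Graph isomorphism (between graphs on possibly different vertex types). -/
def UGraph.Iso {V V' : Type} (G : UGraph V) (H : UGraph V') : Prop :=
  ∃ f : V → V', Set.BijOn f G.verts H.verts ∧
    ∀ x ∈ G.verts, ∀ y ∈ G.verts, (G.adj x y ↔ H.adj (f x) (f y))

/-- A tree decomposition of a (possibly infinite) graph. -/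
structure TreeDecomp {V : Type} (G : UGraph V) where
  ι : Type
  T : SimpleGraph ι
  isTree : T.IsTree
  bag : ι → Set V
  cov_vert : ∀ v ∈ G.verts, ∃ b, v ∈ bag b
  cov_edge : ∀ x y, G.adj x y → ∃ b, x ∈ bag b ∧ y ∈ bag b
  conn : ∀ (v : V) (b b' : ι), v ∈ bag b → v ∈ bag b' →
    Relation.ReflTransGen (fun c c' => T.Adj c c' ∧ v ∈ bag c ∧ v ∈ bag c') b b'

/-- The decomposition has width ≤ k (all bags have at most k+1 elements). -/
def TreeDecomp.WidthLE {V : Type} {G : UGraph V} (td : TreeDecomp G) (k : ℕ) : Prop :=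
  ∀ b, (td.bag b).Finite ∧ (td.bag b).ncard ≤ k + 1

/-- The graph has tree-width ≤ k. -/
def UGraph.TreewidthLE {V : Type} (G : UGraph V) (k : ℕ) : Prop :=
  ∃ td : TreeDecomp G, td.WidthLE k

/-- `TWₖ`: the class of finite graphs of tree-width at most `k`. -/
def TWClass (k : ℕ) : Set (UGraph ℕ) :=
  {G | G.verts.Finite ∧ G.TreewidthLE k}

/-! ## Underlying graphs of conjunctive programs, fragments -/

/-- The list of atoms `(π, x, y)` of `C`. -/
def AtomList.toList : AtomList → List (PDLProgram × ℕ × ℕ)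
  | .nil => []
  | .acons π x y C => (π, x, y) :: C.toList

/-- The variables occurring in `C`. -/
def AtomList.vars (C : AtomList) : Set ℕ :=
  {z | ∃ e ∈ C.toList, z = e.2.1 ∨ z = e.2.2}

/-- The underlying graph `G_C` of a set of atoms `C`. -/
def AtomList.graphC (C : AtomList) : UGraph ℕ where
  verts := C.vars
  adj x y := ∃ e ∈ C.toList, (x = e.2.1 ∧ y = e.2.2) ∨ (x = e.2.2 ∧ y = e.2.1)

/-- The underlying graph `G_{C[x_s,x_t]}`: `G_C` together with the edge `{x_s,x_t}`. -/
def cprogGraph (C : AtomList) (xs xt : ℕ) : UGraph ℕ where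
  verts := C.vars
  adj x y := C.graphC.adj x y ∨ (x = xs ∧ y = xt) ∨ (x = xt ∧ y = xs)

mutual
  /-- Syntactic fragment predicate: `L` allows `loop`, `I` allows `∩`, `N` allows `¬`,
  and every conjunctive program must be well-formed with underlying graph in
  (isomorphic to a member of) the class `𝒢`. -/
  def PDLFormula.OK (L I N : Bool) (𝒢 : Set (UGraph ℕ)) : PDLFormula → Prop
    | .prop _ => True
    | .neg φ => N = true ∧ PDLFormula.OK L I N 𝒢 φ
    | .conj φ ψ => PDLFormula.OK L I N 𝒢 φ ∧ PDLFormula.OK L I N 𝒢 ψ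
    | .diam π => PDLProgram.OK L I N 𝒢 π
    | .floop π => L = true ∧ PDLProgram.OK L I N 𝒢 π
  def PDLProgram.OK (L I N : Bool) (𝒢 : Set (UGraph ℕ)) : PDLProgram → Prop
    | .eps => True
    | .atom _ => True
    | .conv _ => True
    | .punion π ρ => PDLProgram.OK L I N 𝒢 π ∧ PDLProgram.OK L I N 𝒢 ρ
    | .comp π ρ => PDLProgram.OK L I N 𝒢 π ∧ PDLProgram.OK L I N 𝒢 ρ
    | .star π => PDLProgram.OK L I N 𝒢 π
    | .test φ => PDLFormula.OK L I N 𝒢 φ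
    | .inter π ρ => I = true ∧ PDLProgram.OK L I N 𝒢 π ∧ PDLProgram.OK L I N 𝒢 ρ
    | .cprog C xs xt =>
        xs ∈ C.vars ∧ xt ∈ C.vars ∧ (C.graphC).Connected ∧
        (∃ H ∈ 𝒢, (cprogGraph C xs xt).Iso H) ∧ AtomList.OK L I N 𝒢 C
  def AtomList.OK (L I N : Bool) (𝒢 : Set (UGraph ℕ)) : AtomList → Prop
    | .nil => True
    | .acons π _ _ C => PDLProgram.OK L I N 𝒢 π ∧ AtomList.OK L I N 𝒢 C
end

/-- The class of all graphs (no restriction on conjunctive programs). -/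
def FullClass : Set (UGraph ℕ) := Set.univ

/-- The single-vertex graph with a self-loop. -/
def loopGraph : UGraph ℕ := ⟨{0}, fun x y => x = 0 ∧ y = 0⟩

/-- The two-vertex graph with one edge. -/
def capGraph : UGraph ℕ := ⟨{0, 1}, fun x y => (x = 0 ∧ y = 1) ∨ (x = 1 ∧ y = 0)⟩

def GraphLoopClass : Set (UGraph ℕ) := {loopGraph}
def GraphCapClass : Set (UGraph ℕ) := {capGraph}

/-- `CPDL+` formulas: no loop, no intersection, arbitrary conjunctive programs. -/
def IsCPDLPlusFormula (φ : PDLFormula) : Prop := PDLFormula.OK false false true FullClass φ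
def IsCPDLPlusProgram (π : PDLProgram) : Prop := PDLProgram.OK false false true FullClass π
/-- `ICPDL+` formulas: intersection plus arbitrary conjunctive programs. -/
def IsICPDLPlusFormula (φ : PDLFormula) : Prop := PDLFormula.OK false true true FullClass φ
def IsICPDLPlusProgram (π : PDLProgram) : Prop := PDLProgram.OK false true true FullClass π
/-- `ICPDL` formulas: intersection, no conjunctive programs. -/
def IsICPDLFormula (φ : PDLFormula) : Prop := PDLFormula.OK false true true ∅ φ
def IsICPDLProgram (π : PDLProgram) : Prop := PDLProgram.OK false true true ∅ π

/-! ## Underlying graph / tree-width of Kripke structures -/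

/-- `u` is at distance ≤ 1 from `v` in (the underlying undirected graph of) `K`. -/
def Kripke.Near {W P A : Type} (K : Kripke W P A) (u v : W) : Prop :=
  u = v ∨ ∃ a, K.rel a u v ∨ K.rel a v u

/-- The underlying undirected graph of a Kripke structure. -/
def Kripke.graph {W P A : Type} (K : Kripke W P A) : UGraph W :=
  ⟨Set.univ, fun u v => ∃ a, K.rel a u v ∨ K.rel a v u⟩

/-- A Kripke structure has tree-width ≤ k. -/
def Kripke.TreewidthLE {W P A : Type} (K : Kripke W P A) (k : ℕ) : Prop :=
  K.graph.TreewidthLE k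

/-- Every world has finitely many neighbours at distance ≤ 1. -/
def Kripke.FiniteDegree {W P A : Type} (K : Kripke W P A) : Prop :=
  ∀ u : W, {v | K.Near u v}.Finite


/-! ## Downward Loewenheim-Skolem -/

def Kripke.restr {W : Type} (K : Kripke W ℕ ℕ) (S : Set W) : Kripke S ℕ ℕ where
  rel a u v := K.rel a u v
  val p u := K.val p u

def ClosedU {W : Type} (F : W → W → Set W) (S : Set W) : Prop :=
  ∀ u ∈ S, ∀ v ∈ S, F u v ⊆ S

theorem ClosedU.left {W : Type} {F G : W → W → Set W} {S : Set W}
    (h : ClosedU (fun u v => F u v ∪ G u v) S) : ClosedU F S :=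
  fun u hu v hv _ hx => h u hu v hv (Or.inl hx)

theorem ClosedU.right {W : Type} {F G : W → W → Set W} {S : Set W}
    (h : ClosedU (fun u v => F u v ∪ G u v) S) : ClosedU G S :=
  fun u hu v hv _ hx => h u hu v hv (Or.inr hx)

theorem exists_closed {W : Type} (F : W → W → Set W) (hF : ∀ u v, (F u v).Countable) (w : W) :
    ∃ S : Set W, S.Countable ∧ w ∈ S ∧ ClosedU F S := by
  let step : Set W → Set W := fun T => T ∪ ⋃ u ∈ T, ⋃ v ∈ T, F u v
  let A : ℕ → Set W := fun n => Nat.rec {w} (fun _ T => step T) n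
  have hmono : Monotone A := monotone_nat_of_le_succ (fun n => Set.subset_union_left)
  have hc : ∀ n, (A n).Countable := by
    intro n
    induction n with
    | zero => exact Set.countable_singleton w
    | succ n ih =>
      exact ih.union (ih.biUnion fun u _ => ih.biUnion fun v _ => hF u v)
  refine ⟨⋃ n, A n, Set.countable_iUnion hc, Set.mem_iUnion.2 ⟨0, rfl⟩, ?_⟩
  intro u hu v hv x hx
  obtain ⟨i, hi⟩ := Set.mem_iUnion.1 hu
  obtain ⟨j, hj⟩ := Set.mem_iUnion.1 hv
  refine Set.mem_iUnion.2 ⟨max i j + 1, Or.inr ?_⟩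
  simp only [Set.mem_iUnion]
  exact ⟨u, hmono (le_max_left i j) hi, v, hmono (le_max_right i j) hj, hx⟩

theorem exists_wit {W : Type} (Q : W → W → (ℕ → W) → Prop) :
    ∃ G : W → W → Set W, (∀ u v, (G u v).Countable) ∧
      ∀ u v, (∃ g, Q u v g) → ∃ g, Q u v g ∧ ∀ i, g i ∈ G u v := by
  classical
  refine ⟨fun u v => if h : ∃ g, Q u v g then Set.range h.choose else ∅, ?_, ?_⟩
  · intro u v
    dsimp only
    split_ifs
    · exact Set.countable_range _
    · exact Set.countable_empty
  · intro u v h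
    refine ⟨h.choose, h.choose_spec, fun i => ?_⟩
    dsimp only
    rw [dif_pos h]
    exact ⟨i, rfl⟩

theorem rtg_path {W : Type} {r : W → W → Prop} {u v : W} (h : Relation.ReflTransGen r u v) :
    ∃ g : ℕ → W, ∃ n, g 0 = u ∧ g n = v ∧ ∀ i < n, r (g i) (g (i+1)) := by
  induction h using Relation.ReflTransGen.head_induction_on with
  | refl => exact ⟨fun _ => v, 0, rfl, rfl, by simp⟩
  | @head a b hab _ ih =>
    obtain ⟨g, n, h0, hn, hs⟩ := ih
    refine ⟨fun i => Nat.casesOn i a g, n+1, rfl, hn, ?_⟩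
    intro i hi
    cases i with
    | zero => simpa [h0] using hab
    | succ i => exact hs i (by omega)

theorem path_rtg {W : Type} {r : W → W → Prop} (g : ℕ → W) (n : ℕ)
    (h : ∀ i < n, r (g i) (g (i+1))) : Relation.ReflTransGen r (g 0) (g n) := by
  induction n with
  | zero => exact .refl
  | succ n ih => exact (ih fun i hi => h i (by omega)).tail (h n (by omega))

mutual
theorem ls_form {W : Type} (K : Kripke W ℕ ℕ) : ∀ φ : PDLFormula,
    ∃ F : W → W → Set W, (∀ u v, (F u v).Countable) ∧ ∀ S, ClosedU F S →
      ∀ u : S, φ.sat (K.restr S) u ↔ φ.sat K u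
  | .prop p => ⟨fun _ _ => ∅, by simp, fun S _ u => by simp [PDLFormula.sat, Kripke.restr]⟩
  | .neg φ => by
    obtain ⟨F, hF, h⟩ := ls_form K φ
    exact ⟨F, hF, fun S hS u => by simp only [PDLFormula.sat, h S hS u]⟩
  | .conj φ ψ => by
    obtain ⟨F, hF, h⟩ := ls_form K φ
    obtain ⟨G, hG, h'⟩ := ls_form K ψ
    exact ⟨fun u v => F u v ∪ G u v, fun u v => (hF u v).union (hG u v), fun S hS u => by
      simp only [PDLFormula.sat, h S hS.left u, h' S hS.right u]⟩
  | .diam π => by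
    obtain ⟨F, hF, h⟩ := ls_prog K π
    obtain ⟨G, hG, h'⟩ := exists_wit (fun u _ g => π.rel K u (g 0))
    refine ⟨fun u v => F u v ∪ G u v, fun u v => (hF u v).union (hG u v), fun S hS u => ?_⟩
    simp only [PDLFormula.sat]
    constructor
    · rintro ⟨v, hv⟩
      exact ⟨v, (h S hS.left u v).1 hv⟩
    · rintro ⟨v, hv⟩
      obtain ⟨g, hg, hm⟩ := h' u u ⟨fun _ => v, hv⟩
      exact ⟨⟨g 0, hS.right u u.2 u u.2 (hm 0)⟩, (h S hS.left u _).2 hg⟩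
  | .floop π => by
    obtain ⟨F, hF, h⟩ := ls_prog K π
    exact ⟨F, hF, fun S hS u => by simp only [PDLFormula.sat, h S hS u u]⟩
theorem ls_prog {W : Type} (K : Kripke W ℕ ℕ) : ∀ π : PDLProgram,
    ∃ F : W → W → Set W, (∀ u v, (F u v).Countable) ∧ ∀ S, ClosedU F S →
      ∀ u v : S, π.rel (K.restr S) u v ↔ π.rel K u v
  | .eps => ⟨fun _ _ => ∅, by simp, fun S _ u v => by
      simp [PDLProgram.rel, Subtype.ext_iff]⟩
  | .atom a => ⟨fun _ _ => ∅, by simp, fun S _ u v => by simp [PDLProgram.rel, Kripke.restr]⟩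
  | .conv a => ⟨fun _ _ => ∅, by simp, fun S _ u v => by simp [PDLProgram.rel, Kripke.restr]⟩
  | .punion π ρ => by
    obtain ⟨F, hF, h⟩ := ls_prog K π
    obtain ⟨G, hG, h'⟩ := ls_prog K ρ
    exact ⟨fun u v => F u v ∪ G u v, fun u v => (hF u v).union (hG u v), fun S hS u v => by
      simp only [PDLProgram.rel, h S hS.left u v, h' S hS.right u v]⟩
  | .inter π ρ => by
    obtain ⟨F, hF, h⟩ := ls_prog K π
    obtain ⟨G, hG, h'⟩ := ls_prog K ρ
    exact ⟨fun u v => F u v ∪ G u v, fun u v => (hF u v).union (hG u v), fun S hS u v => by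
      simp only [PDLProgram.rel, h S hS.left u v, h' S hS.right u v]⟩
  | .comp π ρ => by
    obtain ⟨F, hF, h⟩ := ls_prog K π
    obtain ⟨G, hG, h'⟩ := ls_prog K ρ
    obtain ⟨H, hH, h''⟩ := exists_wit (fun u v g => π.rel K u (g 0) ∧ ρ.rel K (g 0) v)
    refine ⟨fun u v => (F u v ∪ G u v) ∪ H u v,
      fun u v => ((hF u v).union (hG u v)).union (hH u v), fun S hS u v => ?_⟩
    have hS1 := hS.left.left
    have hS2 := hS.left.right
    simp only [PDLProgram.rel]
    constructor
    · rintro ⟨w, h1, h2⟩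
      exact ⟨w, (h S hS1 _ _).1 h1, (h' S hS2 _ _).1 h2⟩
    · rintro ⟨w, h1, h2⟩
      obtain ⟨g, ⟨g1, g2⟩, hm⟩ := h'' u v ⟨fun _ => w, h1, h2⟩
      exact ⟨⟨g 0, hS.right u u.2 v v.2 (hm 0)⟩, (h S hS1 _ _).2 g1, (h' S hS2 _ _).2 g2⟩
  | .star π => by
    obtain ⟨F, hF, h⟩ := ls_prog K π
    obtain ⟨G, hG, h'⟩ := exists_wit (fun u v g => ∃ n, g 0 = u ∧ g n = v ∧
      ∀ i < n, π.rel K (g i) (g (i+1)))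
    refine ⟨fun u v => F u v ∪ G u v, fun u v => (hF u v).union (hG u v), fun S hS u v => ?_⟩
    simp only [PDLProgram.rel]
    constructor
    · intro huv
      exact huv.lift (fun x : S => (x : W)) (fun a b hab => (h S hS.left a b).1 hab)
    · intro huv
      obtain ⟨g, ⟨n, h0, hn, hs⟩, hm⟩ := h' u v (rtg_path huv)
      let g' : ℕ → S := fun i => ⟨g i, hS.right u u.2 v v.2 (hm i)⟩
      have := path_rtg (r := fun a b => π.rel (K.restr S) a b) g' n
        (fun i hi => (h S hS.left _ _).2 (hs i hi))
      have e0 : g' 0 = u := Subtype.ext h0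
      have en : g' n = v := Subtype.ext hn
      rwa [e0, en] at this
  | .test φ => by
    obtain ⟨F, hF, h⟩ := ls_form K φ
    exact ⟨F, hF, fun S hS u v => by simp only [PDLProgram.rel, h S hS u, Subtype.ext_iff]⟩
  | .cprog C xs xt => by
    obtain ⟨F, hF, h⟩ := ls_list K C
    obtain ⟨G, hG, h'⟩ := exists_wit (fun u v g => g xs = u ∧ g xt = v ∧ C.sat K g)
    refine ⟨fun u v => F u v ∪ G u v, fun u v => (hF u v).union (hG u v), fun S hS u v => ?_⟩
    simp only [PDLProgram.rel]
    constructor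
    · rintro ⟨f, rfl, rfl, hf⟩
      exact ⟨fun x => f x, rfl, rfl, (h S hS.left f).1 hf⟩
    · intro huv
      obtain ⟨g, ⟨h0, hn, hs⟩, hm⟩ := h' u v huv
      exact ⟨fun i => ⟨g i, hS.right u u.2 v v.2 (hm i)⟩, Subtype.ext h0, Subtype.ext hn,
        (h S hS.left _).2 hs⟩
theorem ls_list {W : Type} (K : Kripke W ℕ ℕ) : ∀ C : AtomList,
    ∃ F : W → W → Set W, (∀ u v, (F u v).Countable) ∧ ∀ S, ClosedU F S →
      ∀ f : ℕ → S, C.sat (K.restr S) f ↔ C.sat K (fun x => (f x : W))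
  | .nil => ⟨fun _ _ => ∅, by simp, fun S _ f => by simp [AtomList.sat]⟩
  | .acons π x y C => by
    obtain ⟨F, hF, h⟩ := ls_prog K π
    obtain ⟨G, hG, h'⟩ := ls_list K C
    exact ⟨fun u v => F u v ∪ G u v, fun u v => (hF u v).union (hG u v), fun S hS f => by
      simp only [AtomList.sat, h S hS.left, h' S hS.right f]⟩
end

theorem ls_main (φ : PDLFormula) {W : Type} (K : Kripke W ℕ ℕ) (w : W) (h : φ.sat K w) :
    ∃ (W' : Type) (K' : Kripke W' ℕ ℕ) (w' : W'), Countable W' ∧ φ.sat K' w' := by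
  obtain ⟨F, hF, hS⟩ := ls_form K φ
  obtain ⟨S, hc, hw, hcl⟩ := exists_closed F hF w
  exact ⟨S, K.restr S, ⟨w, hw⟩, hc.to_subtype, (hS S hcl ⟨w, hw⟩).2 h⟩

/-! ## The unravelling -/

section Unravel

/-- Bags: sets of at most `k+1` worlds. -/
abbrev UBag (W : Type) (k : ℕ) : Type := {s : Finset W // s.card ≤ k + 1}

/-- The bag at a node (a node is a list of bags, the head being the current one). -/
def topBag {W : Type} {k : ℕ} : List (UBag W k) → Finset W
  | [] => ∅
  | s :: _ => s.1

open Classical in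
/-- The node at which the current copy of `w` was introduced. -/
noncomputable def origin {W : Type} {k : ℕ} : List (UBag W k) → W → List (UBag W k)
  | [], _ => []
  | s :: n, w => if w ∈ topBag n then origin n w else s :: n

theorem origin_cons {W : Type} {k : ℕ} (s : UBag W k) (n : List (UBag W k)) (w : W)
    (h : w ∈ topBag n) : origin (s :: n) w = origin n w := by
  simp [origin, h]

theorem origin_spec {W : Type} {k : ℕ} (n : List (UBag W k)) (w : W) (h : w ∈ topBag n) :
    w ∈ topBag (origin n w) ∧ origin (origin n w) w = origin n w := by
  induction n with
  | nil => simp [topBag] at h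
  | cons s n ih =>
    by_cases hw : w ∈ topBag n
    · rw [origin_cons s n w hw]
      exact ih hw
    · have e : origin (s :: n) w = s :: n := by simp [origin, hw]
      rw [e, e]
      exact ⟨h, rfl⟩

/-- Worlds of the unravelling. -/
def UWorld (W : Type) (k : ℕ) : Type :=
  {p : List (UBag W k) × W // p.2 ∈ topBag p.1 ∧ origin p.1 p.2 = p.1}

noncomputable def umk {W : Type} {k : ℕ} (n : List (UBag W k)) (w : W) (h : w ∈ topBag n) :
    UWorld W k :=
  ⟨(origin n w, w), origin_spec n w h⟩

theorem umk_eq {W : Type} {k : ℕ} {n m : List (UBag W k)} {w : W} (h : w ∈ topBag n)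
    (h' : w ∈ topBag m) (e : origin n w = origin m w) : umk n w h = umk m w h' :=
  Subtype.ext (Prod.ext e rfl)

theorem umk_cons {W : Type} {k : ℕ} (s : UBag W k) (n : List (UBag W k)) (w : W)
    (hs : w ∈ s.1) (h : w ∈ topBag n) : umk (s :: n) w hs = umk n w h :=
  umk_eq _ _ (origin_cons s n w h)

theorem umk_self {W : Type} {k : ℕ} (p : UWorld W k) : umk p.1.1 p.1.2 p.2.1 = p :=
  Subtype.ext (Prod.ext p.2.2 rfl)

/-- The unravelled structure. -/
noncomputable def Kripke.unr {W : Type} (K : Kripke W ℕ ℕ) (k : ℕ) : Kripke (UWorld W k) ℕ ℕ where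
  rel a p q := K.rel a p.1.2 q.1.2 ∧ ∃ n, ∃ (hp : p.1.2 ∈ topBag n) (hq : q.1.2 ∈ topBag n),
    umk n p.1.2 hp = p ∧ umk n q.1.2 hq = q
  val a p := K.val a p.1.2

/-- The tree of lists. -/
def listTree (B : Type) : SimpleGraph (List B) where
  Adj n m := ∃ s, m = s :: n ∨ n = s :: m
  symm := ⟨fun n m ⟨s, h⟩ => ⟨s, h.symm⟩⟩
  loopless := ⟨fun n ⟨s, h⟩ => by simp at h⟩

theorem listTree_bridge {B : Type} (s : B) (n : List B) :
    ¬ (listTree B \ SimpleGraph.fromEdgeSet {s(n, s :: n)}).Reachable (s :: n) n := by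
  rintro ⟨w⟩
  have key : ∀ a b : List B, (listTree B \ SimpleGraph.fromEdgeSet {s(n, s :: n)}).Walk a b →
      (s :: n) <:+ a → (s :: n) <:+ b := by
    intro a b w
    induction w with
    | nil => exact id
    | @cons u v _ h _ ih =>
      intro hu
      apply ih
      rw [SimpleGraph.sdiff_adj, SimpleGraph.fromEdgeSet_adj] at h
      obtain ⟨⟨t, rfl | rfl⟩, h2⟩ := h
      · exact hu.trans (List.suffix_cons _ _)
      · rw [List.suffix_cons_iff] at hu
        rcases hu with hu | hu
        · exfalso
          apply h2
          rw [List.cons.injEq] at hu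
          obtain ⟨rfl, rfl⟩ := hu
          simp [Sym2.eq_swap]
        · exact hu
  have := (key _ _ w List.suffix_rfl).length_le
  simp at this

theorem listTree_isTree (B : Type) : (listTree B).IsTree := by
  constructor
  · have h : ∀ n : List B, (listTree B).Reachable n [] := by
      intro n
      induction n with
      | nil => exact .refl _
      | cons s n ih =>
        exact (SimpleGraph.Adj.reachable (show (listTree B).Adj (s :: n) n from
          ⟨s, Or.inr rfl⟩)).trans ih
    exact { preconnected := fun a b => (h a).trans (h b).symm, nonempty := ⟨[]⟩ }
  · rw [SimpleGraph.isAcyclic_iff_forall_adj_isBridge]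
    rintro v w ⟨s, rfl | rfl⟩
    · rw [SimpleGraph.isBridge_iff]
      exact fun h => listTree_bridge _ _ h.symm
    · rw [Sym2.eq_swap, SimpleGraph.isBridge_iff]
      exact fun h => listTree_bridge _ _ h.symm

def uTreeBag {W : Type} {k : ℕ} (n : List (UBag W k)) : Set (UWorld W k) :=
  {p | ∃ h : p.1.2 ∈ topBag n, umk n p.1.2 h = p}

theorem uconn {W : Type} {k : ℕ} (p : UWorld W k) (n : List (UBag W k)) (h : p ∈ uTreeBag n) :
    Relation.ReflTransGen (fun c c' => (listTree (UBag W k)).Adj c c' ∧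
      p ∈ uTreeBag c ∧ p ∈ uTreeBag c') n p.1.1 := by
  induction n with
  | nil => obtain ⟨h, _⟩ := h; simp [topBag] at h
  | cons s n ih =>
    have hp := h
    obtain ⟨h1, h2⟩ := h
    by_cases hw : p.1.2 ∈ topBag n
    · have hn : p ∈ uTreeBag n := ⟨hw, (umk_cons s n _ h1 hw).symm.trans h2⟩
      exact (ih hn).head ⟨⟨s, Or.inr rfl⟩, hp, hn⟩
    · have e : origin (s :: n) p.1.2 = s :: n := by simp [origin, hw]
      have : p.1.1 = s :: n := by
        rw [← e, ← h2]; rfl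
      rw [this]

theorem unr_tw {W : Type} (K : Kripke W ℕ ℕ) (k : ℕ) : (K.unr k).TreewidthLE k := by
  refine ⟨{ ι := List (UBag W k)
            T := listTree _
            isTree := listTree_isTree _
            bag := uTreeBag
            cov_vert := fun p _ => ⟨p.1.1, p.2.1, umk_self p⟩
            cov_edge := ?_
            conn := ?_ }, ?_⟩
  · rintro p q ⟨a, ⟨_, n, hp, hq, e1, e2⟩ | ⟨_, n, hp, hq, e1, e2⟩⟩
    · exact ⟨n, ⟨hp, e1⟩, ⟨hq, e2⟩⟩
    · exact ⟨n, ⟨hq, e2⟩, ⟨hp, e1⟩⟩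
  · intro p n m hn hm
    refine (uconn p n hn).trans ?_
    have := (uconn p m hm).swap
    exact Relation.ReflTransGen.mono (fun a b h => ⟨h.1.symm, h.2.2, h.2.1⟩) _ _ this
  · intro n
    have hsub : Set.InjOn (fun p : UWorld W k => p.1.2) (uTreeBag n) := by
      rintro ⟨⟨a, w⟩, hh⟩ ⟨h1, e1⟩ ⟨⟨b, w'⟩, hh'⟩ ⟨h2, e2⟩ (e : w = w')
      subst e
      rw [← e1, ← e2]
    have hmaps : Set.MapsTo (fun p : UWorld W k => p.1.2) (uTreeBag n) (topBag n : Set W) :=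
      fun p hp => hp.1
    have hfin : (topBag n : Set W).Finite := (topBag n).finite_toSet
    refine ⟨Set.Finite.of_injOn hmaps hsub hfin, ?_⟩
    calc (uTreeBag n).ncard ≤ (topBag n : Set W).ncard :=
          Set.ncard_le_ncard_of_injOn _ hmaps hsub hfin
      _ = (topBag n).card := Set.ncard_coe_finset _
      _ ≤ k + 1 := by
          cases n with
          | nil => simp [topBag]
          | cons s n => exact s.2

theorem tree_nodes {ι B : Type} (T : SimpleGraph ι) (hT : T.IsTree) (b0 : ι) (s : ι → B)
    (n : List B) : ∃ N : ι → List B, N b0 = s b0 :: n ∧ (∀ b, ∃ m, N b = s b :: m) ∧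
      ∀ b c, T.Adj b c → N c = s c :: N b ∨ N b = s b :: N c := by
  classical
  have hex := fun b => (hT.existsUnique_path b0 b)
  choose P hP hU using hex
  have hU' : ∀ b (q : T.Walk b0 b), q.IsPath → q = P b := fun b q hq => hU b q hq
  let N' : ∀ {b}, T.Walk b0 b → List B := fun {b} p => p.support.reverse.map s ++ n
  have hconc : ∀ {b c} (p : T.Walk b0 b) (h : T.Adj b c), N' (p.concat h) = s c :: N' p := by
    intro b c p h
    simp [N', SimpleGraph.Walk.support_concat]
  refine ⟨fun b => N' (P b), ?_, ?_, ?_⟩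
  · dsimp only
    rw [← hU' b0 .nil SimpleGraph.Walk.IsPath.nil]
    simp [N']
  · intro b
    refine ⟨((P b).support.dropLast).reverse.map s ++ n, ?_⟩
    have := List.dropLast_append_getLast (l := (P b).support) (by simp)
    rw [SimpleGraph.Walk.getLast_support] at this
    have e : (P b).support.reverse = b :: (P b).support.dropLast.reverse := by
      rw [← List.reverse_concat, this]
    simp only [N', e, List.map_cons, List.cons_append]
  · intro b c h
    dsimp only
    by_cases hc : c ∈ (P b).support
    · right
      have hb : b ∉ ((P b).takeUntil c hc).support :=
        SimpleGraph.Walk.endpoint_notMem_support_takeUntil (hP b) hc h.ne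
      have hp := (hP b).takeUntil hc
      rw [← hU' b _ (hp.concat hb h.symm), hconc, hU' c _ hp]
    · left
      rw [← hU' c _ ((hP b).concat hc h), hconc]

theorem list_sat_iff {W : Type} (K : Kripke W ℕ ℕ) (C : AtomList) (f : ℕ → W) :
    C.sat K f ↔ ∀ e ∈ C.toList, e.1.rel K (f e.2.1) (f e.2.2) := by
  induction C using AtomList.rec (motive_1 := fun _ => True) (motive_2 := fun _ => True) with
  | nil => simp [AtomList.sat, AtomList.toList]
  | acons π x y C _ ih => simp [AtomList.sat, AtomList.toList, ih]
  | _ => trivial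

/-- Transfer properties of a program between `K` and its unravelling. -/
def Good {W : Type} (K : Kripke W ℕ ℕ) (k : ℕ) (π : PDLProgram) : Prop :=
  (∀ p q : UWorld W k, π.rel (K.unr k) p q → π.rel K p.1.2 q.1.2) ∧
  ∀ (n : List (UBag W k)) (u v : W) (hu : u ∈ topBag n) (hv : v ∈ topBag n),
    π.rel K u v → π.rel (K.unr k) (umk n u hu) (umk n v hv)

theorem good_cprog {W : Type} (K : Kripke W ℕ ℕ) (k : ℕ) (C : AtomList) (xs xt : ℕ)
    (hs : xs ∈ C.vars) (ht : xt ∈ C.vars)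
    (hH : ∃ H ∈ TWClass k, (cprogGraph C xs xt).Iso H)
    (hC : ∀ e ∈ C.toList, Good K k e.1) : Good K k (.cprog C xs xt) := by
  classical
  constructor
  · intro p q h
    simp only [PDLProgram.rel, list_sat_iff] at h ⊢
    obtain ⟨f, rfl, rfl, hf⟩ := h
    exact ⟨fun x => (f x).1.2, rfl, rfl, fun e he => (hC e he).1 _ _ (hf e he)⟩
  · intro n u v hu hv h
    simp only [PDLProgram.rel, list_sat_iff] at h ⊢
    obtain ⟨f, rfl, rfl, hf⟩ := h
    obtain ⟨H, ⟨-, td, hw⟩, h, hbij, hadj⟩ := hH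
    obtain ⟨b0, hb1, hb2⟩ := td.cov_edge (h xs) (h xt)
      ((hadj xs hs xt ht).1 (Or.inr (Or.inl ⟨rfl, rfl⟩)))
    have hsfin : ∀ b, ({x ∈ C.vars | h x ∈ td.bag b}).Finite := fun b =>
      Set.Finite.of_injOn (f := h) (t := td.bag b) (fun x hx => hx.2)
        (hbij.injOn.mono fun x hx => hx.1) (hw b).1
    have hsc : ∀ b, ((hsfin b).toFinset.image f).card ≤ k + 1 := by
      intro b
      refine Finset.card_image_le.trans ?_
      rw [← Set.ncard_eq_toFinset_card _ (hsfin b)]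
      exact (Set.ncard_le_ncard_of_injOn h (fun x hx => hx.2)
        (hbij.injOn.mono fun x hx => hx.1) (hw b).1).trans (hw b).2
    let s : td.ι → UBag W k := fun b => ⟨(hsfin b).toFinset.image f, hsc b⟩
    have hmem : ∀ b x, x ∈ C.vars → h x ∈ td.bag b → f x ∈ (s b).1 := by
      intro b x hx hb
      exact Finset.mem_image_of_mem f ((hsfin b).mem_toFinset.2 ⟨hx, hb⟩)
    obtain ⟨N, hN0, hNb, hNadj⟩ := tree_nodes td.T td.isTree b0 s n
    have hmemN : ∀ b x, x ∈ C.vars → h x ∈ td.bag b → f x ∈ topBag (N b) := by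
      intro b x hx hb
      obtain ⟨m, hm⟩ := hNb b
      rw [hm]
      exact hmem b x hx hb
    have horig : ∀ x (hx : x ∈ C.vars) b b', h x ∈ td.bag b → h x ∈ td.bag b' →
        origin (N b) (f x) = origin (N b') (f x) := by
      intro x hx b b' hb hb'
      have hc := td.conn (h x) b b' hb hb'
      clear hb'
      induction hc with
      | refl => rfl
      | @tail c d _ hcd ih =>
        rw [ih]
        obtain ⟨ha, h1, h2⟩ := hcd
        rcases hNadj c d ha with e | e
        · rw [e, origin_cons _ _ _ (hmemN c x hx h1)]
        · rw [e, origin_cons _ _ _ (hmemN d x hx h2)]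
    have hcov : ∀ x, x ∈ C.vars → ∃ b, h x ∈ td.bag b := fun x hx =>
      td.cov_vert _ (hbij.mapsTo hx)
    let g : ℕ → UWorld W k := fun x =>
      if hx : x ∈ C.vars then umk (N (hcov x hx).choose) (f x)
        (hmemN _ x hx (hcov x hx).choose_spec) else umk n (f xs) hu
    have hg : ∀ x (hx : x ∈ C.vars) b (hb : h x ∈ td.bag b),
        g x = umk (N b) (f x) (hmemN b x hx hb) := by
      intro x hx b hb
      simp only [g, dif_pos hx]
      exact umk_eq _ _ (horig x hx _ _ (hcov x hx).choose_spec hb)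
    refine ⟨g, ?_, ?_, ?_⟩
    · rw [hg xs hs b0 hb1]
      exact umk_eq _ _ (by rw [hN0, origin_cons _ _ _ hu])
    · rw [hg xt ht b0 hb2]
      exact umk_eq _ _ (by rw [hN0, origin_cons _ _ _ hv])
    · intro e he
      have h1 : e.2.1 ∈ C.vars := ⟨e, he, Or.inl rfl⟩
      have h2 : e.2.2 ∈ C.vars := ⟨e, he, Or.inr rfl⟩
      obtain ⟨b, hb1, hb2⟩ := td.cov_edge (h e.2.1) (h e.2.2)
        ((hadj _ h1 _ h2).1 (Or.inl ⟨e, he, Or.inl ⟨rfl, rfl⟩⟩))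
      rw [hg _ h1 b hb1, hg _ h2 b hb2]
      exact (hC e he).2 _ _ _ _ _ (hf e he)

open Classical in
/-- A bag with three elements. -/
noncomputable def bag3 {W : Type} {k : ℕ} (hk : 2 ≤ k) (u v w : W) : UBag W k :=
  ⟨{u, v, w}, Finset.card_le_three.trans (by omega)⟩

theorem good_comp {W : Type} (K : Kripke W ℕ ℕ) (k : ℕ) (hk : 2 ≤ k) (π ρ : PDLProgram)
    (h1 : Good K k π) (h2 : Good K k ρ) : Good K k (.comp π ρ) := by
  constructor
  · intro p q h
    simp only [PDLProgram.rel] at h ⊢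
    obtain ⟨r, ha, hb⟩ := h
    exact ⟨r.1.2, h1.1 _ _ ha, h2.1 _ _ hb⟩
  · intro n u v hu hv h
    simp only [PDLProgram.rel] at h ⊢
    obtain ⟨w, ha, hb⟩ := h
    have mu : u ∈ (bag3 hk u v w).1 := by simp [bag3]
    have mv : v ∈ (bag3 hk u v w).1 := by simp [bag3]
    have mw : w ∈ (bag3 hk u v w).1 := by simp [bag3]
    rw [← umk_cons (bag3 hk u v w) n u mu hu, ← umk_cons (bag3 hk u v w) n v mv hv]
    exact ⟨umk (bag3 hk u v w :: n) w mw, h1.2 _ _ _ _ _ ha, h2.2 _ _ _ _ _ hb⟩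

theorem good_star {W : Type} (K : Kripke W ℕ ℕ) (k : ℕ) (hk : 2 ≤ k) (π : PDLProgram)
    (h1 : Good K k π) : Good K k (.star π) := by
  constructor
  · intro p q h
    simp only [PDLProgram.rel] at h ⊢
    exact h.lift (fun x : UWorld W k => x.1.2) (fun a b hab => h1.1 a b hab)
  · intro n u v hu hv h
    simp only [PDLProgram.rel] at h ⊢
    induction h using Relation.ReflTransGen.head_induction_on generalizing n with
    | refl => exact .refl
    | @head u w ha _ ih =>
      have mu : u ∈ (bag3 hk u v w).1 := by simp [bag3]
      have mv : v ∈ (bag3 hk u v w).1 := by simp [bag3]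
      have mw : w ∈ (bag3 hk u v w).1 := by simp [bag3]
      rw [← umk_cons (bag3 hk u v w) n u mu hu, ← umk_cons (bag3 hk u v w) n v mv hv]
      exact (ih (bag3 hk u v w :: n) mw mv).head (h1.2 _ _ _ _ mw ha)

mutual
theorem unr_form {W : Type} (K : Kripke W ℕ ℕ) (k : ℕ) (hk : 2 ≤ k) : ∀ φ : PDLFormula,
    PDLFormula.OK false false true (TWClass k) φ →
    ∀ p : UWorld W k, φ.sat (K.unr k) p ↔ φ.sat K p.1.2
  | .prop a, _, p => by simp [PDLFormula.sat, Kripke.unr]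
  | .neg φ, h, p => by
    simp only [PDLFormula.OK] at h
    simp only [PDLFormula.sat, unr_form K k hk φ h.2 p]
  | .conj φ ψ, h, p => by
    simp only [PDLFormula.OK] at h
    simp only [PDLFormula.sat, unr_form K k hk φ h.1 p, unr_form K k hk ψ h.2 p]
  | .diam π, h, p => by
    simp only [PDLFormula.OK] at h
    have hg := unr_prog K k hk π h
    simp only [PDLFormula.sat]
    constructor
    · rintro ⟨q, hq⟩
      exact ⟨q.1.2, hg.1 _ _ hq⟩
    · rintro ⟨v, hv⟩
      have mu : p.1.2 ∈ (bag3 hk p.1.2 v v).1 := by simp [bag3]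
      have mv : v ∈ (bag3 hk p.1.2 v v).1 := by simp [bag3]
      have := hg.2 (bag3 hk p.1.2 v v :: p.1.1) _ _ mu mv hv
      rw [umk_cons _ _ _ mu p.2.1, umk_self p] at this
      exact ⟨_, this⟩
  | .floop π, h, p => by simp [PDLFormula.OK] at h
theorem unr_prog {W : Type} (K : Kripke W ℕ ℕ) (k : ℕ) (hk : 2 ≤ k) : ∀ π : PDLProgram,
    PDLProgram.OK false false true (TWClass k) π → Good K k π
  | .eps, _ => by
    constructor
    · intro p q h
      simp only [PDLProgram.rel] at h ⊢
      rw [h]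
    · intro n u v hu hv h
      simp only [PDLProgram.rel] at h ⊢
      subst h; rfl
  | .atom a, _ => by
    constructor
    · intro p q h
      simp only [PDLProgram.rel] at h ⊢
      exact h.1
    · intro n u v hu hv h
      simp only [PDLProgram.rel] at h ⊢
      exact ⟨h, n, hu, hv, rfl, rfl⟩
  | .conv a, _ => by
    constructor
    · intro p q h
      simp only [PDLProgram.rel] at h ⊢
      exact h.1
    · intro n u v hu hv h
      simp only [PDLProgram.rel] at h ⊢
      exact ⟨h, n, hv, hu, rfl, rfl⟩
  | .punion π ρ, h => by
    simp only [PDLProgram.OK] at h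
    have h1 := unr_prog K k hk π h.1
    have h2 := unr_prog K k hk ρ h.2
    constructor
    · intro p q h
      simp only [PDLProgram.rel] at h ⊢
      exact h.imp (h1.1 _ _) (h2.1 _ _)
    · intro n u v hu hv h
      simp only [PDLProgram.rel] at h ⊢
      exact h.imp (h1.2 _ _ _ _ _) (h2.2 _ _ _ _ _)
  | .comp π ρ, h => by
    simp only [PDLProgram.OK] at h
    exact good_comp K k hk π ρ (unr_prog K k hk π h.1) (unr_prog K k hk ρ h.2)
  | .star π, h => by
    simp only [PDLProgram.OK] at h
    exact good_star K k hk π (unr_prog K k hk π h)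
  | .test φ, h => by
    simp only [PDLProgram.OK] at h
    have h1 := unr_form K k hk φ h
    constructor
    · intro p q h
      simp only [PDLProgram.rel] at h ⊢
      obtain ⟨rfl, h⟩ := h
      exact ⟨rfl, (h1 p).1 h⟩
    · intro n u v hu hv h
      simp only [PDLProgram.rel] at h ⊢
      obtain ⟨rfl, h⟩ := h
      exact ⟨rfl, (h1 _).2 h⟩
  | .inter π ρ, h => by simp [PDLProgram.OK] at h
  | .cprog C xs xt, h => by
    simp only [PDLProgram.OK] at h
    exact good_cprog K k C xs xt h.1 h.2.1 h.2.2.2.1 (unr_list K k hk C h.2.2.2.2)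
theorem unr_list {W : Type} (K : Kripke W ℕ ℕ) (k : ℕ) (hk : 2 ≤ k) : ∀ C : AtomList,
    AtomList.OK false false true (TWClass k) C → ∀ e ∈ C.toList, Good K k e.1
  | .nil, _ => by simp [AtomList.toList]
  | .acons π x y C, h => by
    simp only [AtomList.OK] at h
    have h1 := unr_prog K k hk π h.1
    have h2 := unr_list K k hk C h.2
    intro e he
    simp only [AtomList.toList, List.mem_cons] at he
    rcases he with rfl | he
    · exact h1
    · exact h2 e he
end

end Unravel

/-- Corollary 2 of the paper: `CPDL(TWₖ)` has the `TWₖ`-model property: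
every satisfiable `CPDL(TWₖ)` formula is satisfiable in a countable Kripke structure of
tree-width at most `k`. -/
theorem twk_model_property (k : ℕ) (hk : 2 ≤ k) (φ : PDLFormula)
    (hφ : PDLFormula.OK false false true (TWClass k) φ)
    (hsat : ∃ (W : Type) (K : Kripke W ℕ ℕ) (w : W), φ.sat K w) :
    ∃ (W : Type) (K : Kripke W ℕ ℕ) (w : W),
      Countable W ∧ K.TreewidthLE k ∧ φ.sat K w := by
  obtain ⟨W0, K0, w0, h0⟩ := hsat
  obtain ⟨W, K, w, hc, hw⟩ := ls_main φ K0 w0 h0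
  let s : UBag W k := ⟨{w}, by simp⟩
  have ms : w ∈ topBag [s] := by simp [topBag, s]
  refine ⟨UWorld W k, K.unr k, umk [s] w ms, ?_, unr_tw K k, ?_⟩
  · unfold UWorld
    infer_instance
  · exact (unr_form K k hk φ hφ _).2 hw
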